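/- arXiv:1302.4063 — 4 statements merged into one kernel-verified Lean document; each statement's English description precedes it below -/
import Mathlib

section
/- For every integer n ≥ 3, the total number of occurrences of the pattern 312 in the set S_n(123,132,213) equals ∑_{w ∈ B_{n−1}} maj(w), the sum of the major indices of all Fibonacci binary words of length n−1. -/
open Finset

/-- Number of occurrences of the length-3 pattern `q` (given by its sequence of values)
in the permutation `σ` of `Fin n`: triples of indices `ι 0 < ι 1 < ι 2` whose values under
`σ` are in the same relative order as the values of `q`. -/
def occ (n : ℕ) (q : Fin 3 → ℕ) (σ : Equiv.Perm (Fin n)) : ℕ :=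
  (Finset.univ.filter fun ι : Fin 3 → Fin n =>
    (∀ j l : Fin 3, j < l → ι j < ι l) ∧
    (∀ j l : Fin 3, q j < q l ↔ σ (ι j) < σ (ι l))).card

/-- The set `S_n(R)` of permutations of `{1,…,n}` avoiding every pattern in `R`. -/
def avoiders (n : ℕ) (R : List (Fin 3 → ℕ)) : Finset (Equiv.Perm (Fin n)) :=
  Finset.univ.filter fun σ => ∀ q ∈ R, occ n q σ = 0

/-- `f_q(S_n(R))`: the total number of occurrences of the pattern `q` among
all permutations in `S_n(R)`. -/
def fCnt (n : ℕ) (q : Fin 3 → ℕ) (R : List (Fin 3 → ℕ)) : ℕ :=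
  ∑ σ ∈ avoiders n R, occ n q σ

def p123 : Fin 3 → ℕ := ![1, 2, 3]
def p132 : Fin 3 → ℕ := ![1, 3, 2]
def p213 : Fin 3 → ℕ := ![2, 1, 3]
def p231 : Fin 3 → ℕ := ![2, 3, 1]
def p312 : Fin 3 → ℕ := ![3, 1, 2]
def p321 : Fin 3 → ℕ := ![3, 2, 1]

/-- The set of Fibonacci binary words of length `m`: 0-1 sequences with no
two consecutive ones. -/
def FibWords (m : ℕ) : Finset (Fin m → Fin 2) :=
  Finset.univ.filter fun w =>
    ∀ i j : Fin m, (j : ℕ) = (i : ℕ) + 1 → ¬(w i = 1 ∧ w j = 1)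

/-- The major index of a word `w = w₁…w_m`: the sum of all (1-indexed) positions `i < m`
with `w_i < w_{i+1}`. -/
def maj {m : ℕ} (w : Fin m → Fin 2) : ℕ :=
  ∑ i ∈ (Finset.range (m - 1)).attach,
    if w ⟨i.1, by have := Finset.mem_range.mp i.2; omega⟩ <
        w ⟨i.1 + 1, by have := Finset.mem_range.mp i.2; omega⟩ then i.1 + 1 else 0

theorem occ_eq_zero_iff {n : ℕ} (q : Fin 3 → ℕ) (σ : Equiv.Perm (Fin n)) :
    occ n q σ = 0 ↔ ∀ a b c : Fin n, a < b → b < c →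
      ¬ ∀ j l : Fin 3, q j < q l ↔ σ (![a, b, c] j) < σ (![a, b, c] l) := by
  unfold occ
  rw [Finset.card_eq_zero, Finset.filter_eq_empty_iff]
  constructor
  · intro h a b c hab hbc hq
    refine h (Finset.mem_univ ![a, b, c]) ⟨?_, hq⟩
    simp [Fin.forall_fin_succ, hab, hbc, hab.trans hbc]
  · rintro h ι - ⟨hι, hq⟩
    refine h (ι 0) (ι 1) (ι 2) (hι 0 1 (by decide)) (hι 1 2 (by decide)) ?_
    have : ![ι 0, ι 1, ι 2] = ι := by ext i; fin_cases i <;> rfl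
    rwa [this]

/-- A permutation avoids 123, 132 and 213 exactly when its only non-inversions are
between adjacent positions. -/
theorem mem_avoiders_iff {n : ℕ} (σ : Equiv.Perm (Fin n)) :
    σ ∈ avoiders n [p123, p132, p213] ↔
      ∀ j l : Fin n, (j : ℕ) + 2 ≤ l → σ l < σ j := by
  simp only [avoiders, Finset.mem_filter, Finset.mem_univ, true_and, List.mem_cons,
    List.not_mem_nil, or_false, forall_eq_or_imp, forall_eq, occ_eq_zero_iff]
  constructor
  · rintro ⟨h₁, h₂, h₃⟩ j l hjl
    by_contra! hlt
    let k : Fin n := ⟨j + 1, by omega⟩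
    have hjk : j < k := Fin.lt_def.2 (by simp [k])
    have hkl : k < l := Fin.lt_def.2 (by simp [k]; omega)
    have n₁ : σ j ≠ σ k := fun h => hjk.ne (σ.injective h)
    have n₂ : σ k ≠ σ l := fun h => hkl.ne (σ.injective h)
    have n₃ : σ j ≠ σ l := fun h => (hjk.trans hkl).ne (σ.injective h)
    specialize h₁ j k l hjk hkl
    specialize h₂ j k l hjk hkl
    specialize h₃ j k l hjk hkl
    simp [Fin.forall_fin_succ, p123, p132, p213] at h₁ h₂ h₃
    grind
  · intro h
    refine ⟨?_, ?_, ?_⟩ <;> intro a b c hab hbc hq <;>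
      exact lt_asymm ((hq 0 2).1 (by decide)) (h a c (by rw [Fin.lt_def] at hab hbc; omega))

/-- The ascent word of a permutation: its `i`-th letter is `1` iff `i` is an ascent. -/
def ascentWord {m : ℕ} (σ : Equiv.Perm (Fin (m + 1))) (i : Fin m) : Fin 2 :=
  if σ i.castSucc < σ i.succ then 1 else 0

theorem ascentWord_eq_one_iff {m : ℕ} (σ : Equiv.Perm (Fin (m + 1))) (i : Fin m) :
    ascentWord σ i = 1 ↔ σ i.castSucc < σ i.succ := by
  simp [ascentWord]

theorem ascentWord_mem_fibWords {m : ℕ} {σ : Equiv.Perm (Fin (m + 1))}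
    (hσ : σ ∈ avoiders (m + 1) [p123, p132, p213]) : ascentWord σ ∈ FibWords m := by
  rw [mem_avoiders_iff] at hσ
  simp only [FibWords, Finset.mem_filter, Finset.mem_univ, true_and, ascentWord_eq_one_iff]
  rintro i j hij ⟨hi, hj⟩
  have hs : i.succ = j.castSucc := Fin.ext (by simp [hij])
  rw [hs] at hi
  exact lt_asymm (hi.trans hj) (hσ _ _ (by simp [hij]))

theorem lt_iff_of_mem_avoiders {m : ℕ} {σ : Equiv.Perm (Fin (m + 1))}
    (hσ : σ ∈ avoiders (m + 1) [p123, p132, p213]) {j l : Fin (m + 1)} (hjl : j < l) :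
    σ j < σ l ↔ ∃ i : Fin m, j = i.castSucc ∧ l = i.succ ∧ ascentWord σ i = 1 := by
  rw [mem_avoiders_iff] at hσ
  simp only [ascentWord_eq_one_iff]
  constructor
  · intro h
    have hl : (l : ℕ) = j + 1 := by
      by_contra hne
      rw [Fin.lt_def] at hjl
      exact lt_asymm h (hσ j l (by omega))
    have hj : j = Fin.castSucc ⟨j, by omega⟩ := rfl
    have hl' : l = Fin.succ ⟨j, by omega⟩ := Fin.ext (by simp [hl])
    exact ⟨⟨j, by omega⟩, hj, hl', by rwa [← hj, ← hl']⟩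
  · rintro ⟨i, rfl, rfl, h⟩
    exact h

theorem perm_eq_of_lt_iff {n : ℕ} {σ τ : Equiv.Perm (Fin n)}
    (h : ∀ j l, j < l → (σ j < σ l ↔ τ j < τ l)) : σ = τ := by
  have h' : ∀ j l, σ j < σ l ↔ τ j < τ l := by
    intro j l
    rcases lt_trichotomy j l with hlt | rfl | hgt
    · exact h j l hlt
    · simp
    · have := h l j hgt
      have n₁ : σ l ≠ σ j := fun e => hgt.ne (σ.injective e)
      have n₂ : τ l ≠ τ j := fun e => hgt.ne (τ.injective e)
      grind
  have card_eq : ∀ (ρ : Equiv.Perm (Fin n)) (l : Fin n),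
      (Finset.univ.filter fun j => ρ j < ρ l).card = (ρ l : ℕ) := by
    intro ρ l
    rw [← Fin.card_Iio (ρ l), ← Finset.card_map ρ.toEmbedding]
    congr 1
    ext x
    simp only [Finset.mem_map, Finset.mem_filter, Finset.mem_univ, true_and, Finset.mem_Iio]
    exact ⟨by rintro ⟨y, hy, rfl⟩; exact hy, fun hx => ⟨ρ.symm x, by simpa using hx, by simp⟩⟩
  ext l
  rw [← card_eq σ l, ← card_eq τ l]
  simp only [h']

theorem ascentWord_injOn {m : ℕ} {σ τ : Equiv.Perm (Fin (m + 1))}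
    (hσ : σ ∈ avoiders (m + 1) [p123, p132, p213])
    (hτ : τ ∈ avoiders (m + 1) [p123, p132, p213])
    (h : ascentWord σ = ascentWord τ) : σ = τ :=
  perm_eq_of_lt_iff fun j l hjl => by
    rw [lt_iff_of_mem_avoiders hσ hjl, lt_iff_of_mem_avoiders hτ hjl, h]

theorem exists_ascentWord_eq {m : ℕ} {w : Fin m → Fin 2} (hw : w ∈ FibWords m) :
    ∃ σ ∈ avoiders (m + 1) [p123, p132, p213], ascentWord σ = w := by
  simp only [FibWords, Finset.mem_filter, Finset.mem_univ, true_and] at hw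
  obtain ⟨e, he⟩ : ∃ e : ℕ → ℕ, ∀ i, e i = if h : i < m then (w ⟨i, h⟩ : ℕ) else 0 :=
    ⟨_, fun _ => rfl⟩
  have e_le : ∀ i, e i + e (i + 1) ≤ 1 := by
    intro i
    rw [he, he]
    split_ifs with h₁ h₂
    · have := hw ⟨i, h₁⟩ ⟨i + 1, h₂⟩ rfl
      simp only [Fin.ext_iff, Fin.val_one] at this
      omega
    all_goals omega
  have e_big : ∀ i, m ≤ i → e i = 0 := fun i hi => by rw [he, dif_neg (by omega)]
  obtain ⟨p, hp₀, hp⟩ : ∃ p : ℕ → ℕ, p 0 = 0 ∧ ∀ i, p (i + 1) = e i :=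
    ⟨fun i => Nat.casesOn i 0 e, rfl, fun _ => rfl⟩
  have p_le : ∀ i, p i + e i ≤ 1 := by
    rintro (_ | i)
    · have := e_le 0; omega
    · rw [hp]; exact e_le i
  obtain ⟨f, hf⟩ : ∃ f : ℕ → ℕ, ∀ i, f i = m - i - e i + p i := ⟨_, fun _ => rfl⟩
  have f_far : ∀ i l, i + 2 ≤ l → l ≤ m → f l < f i := by
    intro i l hil hl
    have h₁ := p_le i
    have h₂ := p_le l
    rw [hf, hf]
    obtain rfl | h := eq_or_ne l (i + 2)
    · have h₃ : p (i + 2) = e (i + 1) := hp (i + 1)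
      have h₄ := e_le i
      omega
    · omega
  have f_succ : ∀ i, i < m → (f i < f (i + 1) ↔ e i = 1) ∧ f i ≠ f (i + 1) := by
    intro i hi
    have h₁ := p_le i
    have h₂ := e_le i
    have h₃ := e_big (i + 1)
    rw [hf, hf, hp]
    omega
  have f_lt : ∀ i, i < m + 1 → f i < m + 1 := by
    rintro (_ | i) hi
    · rw [hf, hp₀]; omega
    · have := p_le (i + 1)
      rw [hf]; omega
  let g : Fin (m + 1) → Fin (m + 1) := fun i => ⟨f i, f_lt i i.2⟩
  have g_ne : ∀ i l : Fin (m + 1), i < l → g i ≠ g l := by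
    intro i l hil h
    simp only [g, Fin.mk.injEq] at h
    rw [Fin.lt_def] at hil
    by_cases hl : (l : ℕ) = i + 1
    · rw [hl] at h
      exact (f_succ i (by omega)).2 h
    · exact (f_far i l (by omega) (by omega)).ne' h
  have g_inj : Function.Injective g := fun i l h => by
    by_contra hne
    rcases lt_or_gt_of_ne hne with h' | h'
    · exact g_ne _ _ h' h
    · exact g_ne _ _ h' h.symm
  refine ⟨Equiv.ofBijective g (Finite.injective_iff_bijective.1 g_inj), ?_, ?_⟩
  · rw [mem_avoiders_iff]
    intro j l hjl
    exact f_far j l hjl (by omega)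
  · funext i
    have h₁ : f i < f (i + 1) ↔ w i = 1 := by
      rw [(f_succ i i.2).1, he, dif_pos i.2, Fin.ext_iff, Fin.val_one]
    have h₂ : ascentWord (Equiv.ofBijective g (Finite.injective_iff_bijective.1 g_inj)) i = 1 ↔
        w i = 1 := by
      rw [ascentWord_eq_one_iff, ← h₁]
      rfl
    generalize ascentWord _ i = x at h₂
    generalize w i = y at h₂
    revert x y
    decide

theorem occ_p312_eq_sum {m : ℕ} {σ : Equiv.Perm (Fin (m + 1))}
    (hσ : σ ∈ avoiders (m + 1) [p123, p132, p213]) :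
    occ (m + 1) p312 σ = ∑ b : Fin m, if ascentWord σ b = 1 then (b : ℕ) else 0 := by
  have hcard : ∀ b : Fin m, (b : ℕ) = (Finset.Iio b.castSucc).card := fun b => by simp
  rw [← Finset.sum_filter, Finset.sum_congr rfl fun b _ => hcard b, ← Finset.card_sigma]
  symm
  refine Finset.card_bij (fun x _ => ![x.2, x.1.castSucc, x.1.succ]) ?_ ?_ ?_
  · rintro ⟨b, a⟩ hx
    simp only [Finset.mem_sigma, Finset.mem_filter, Finset.mem_univ, true_and,
      Finset.mem_Iio, ascentWord_eq_one_iff] at hx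
    obtain ⟨hb, ha⟩ := hx
    have hs : b.castSucc < b.succ := Fin.castSucc_lt_succ
    have h₁ : σ b.succ < σ a := by
      rw [mem_avoiders_iff] at hσ
      refine hσ _ _ ?_
      rw [Fin.lt_def] at ha
      simp at ha ⊢
      omega
    have h₂ := hb.trans h₁
    simp [Fin.forall_fin_succ, p312, ha, hs, ha.trans hs, hb, h₁, h₂, hb.le, h₁.le, h₂.le]
  · rintro ⟨b, a⟩ - ⟨b', a'⟩ - h
    have h₀ := congrFun h 0
    have h₁ := congrFun h 1
    simp at h₀ h₁
    subst h₀ h₁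
    rfl
  · intro ι hι
    simp only [Finset.mem_filter, Finset.mem_univ, true_and] at hι
    obtain ⟨hι, hq⟩ := hι
    have h₁₂ := (hq 1 2).1 (by decide)
    obtain ⟨b, h₁, h₂, hb⟩ := (lt_iff_of_mem_avoiders hσ (hι 1 2 (by decide))).1 h₁₂
    refine ⟨⟨b, ι 0⟩, ?_, ?_⟩
    · simp [hb, ← h₁, hι 0 1 (by decide)]
    · funext i
      fin_cases i
      · rfl
      · exact h₁.symm
      · exact h₂.symm

theorem maj_eq_sum {m : ℕ} {w : Fin m → Fin 2} (hw : w ∈ FibWords m) :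
    maj w = ∑ b : Fin m, if w b = 1 then (b : ℕ) else 0 := by
  simp only [FibWords, Finset.mem_filter, Finset.mem_univ, true_and] at hw
  cases m with
  | zero => simp [maj]
  | succ k =>
    rw [Fin.sum_univ_succ]
    simp only [Fin.val_zero, ite_self, zero_add]
    refine Finset.sum_bij' (fun i _ => (⟨i.1, Finset.mem_range.1 i.2⟩ : Fin k))
      (fun i _ => ⟨i.1, Finset.mem_range.2 i.2⟩) ?_ ?_ ?_ ?_ ?_
    · simp
    · simp
    · simp
    · simp
    · rintro ⟨i, hi⟩ -
      have hi' : i < k := Finset.mem_range.1 hi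
      have h := hw ⟨i, by omega⟩ ⟨i + 1, by omega⟩ rfl
      simp only [Fin.succ_mk]
      congr 1
      generalize w ⟨i, _⟩ = x at h
      generalize w ⟨i + 1, _⟩ = y at h
      revert x y
      decide

/-- Proposition `paa`: for `n ≥ 3`, the total number of occurrences of the pattern 312 in
`S_n(123,132,213)` equals the sum of the major indices of all Fibonacci binary words of
length `n−1`. -/
theorem stmt_11 (n : ℕ) (hn : 3 ≤ n) :
    fCnt n p312 [p123, p132, p213] = ∑ w ∈ FibWords (n - 1), maj w := by
  obtain ⟨m, rfl⟩ : ∃ m, n = m + 1 := ⟨n - 1, by omega⟩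
  refine Finset.sum_bij (fun σ _ => ascentWord σ) (fun _ hσ => ascentWord_mem_fibWords hσ)
    (fun _ hσ _ hτ h => ascentWord_injOn hσ hτ h) (fun _ hw => ?_) fun σ hσ => ?_
  · obtain ⟨σ, hσ, h⟩ := exists_ascentWord_eq hw
    exact ⟨σ, hσ, h⟩
  · exact (occ_p312_eq_sum hσ).trans (maj_eq_sum (ascentWord_mem_fibWords hσ)).symm
end

section
/- Let M_n(q) = ∑_{w ∈ B_n} q^{maj(w)} ∈ ℤ[q] be the generating polynomial of the major index over Fibonacci binary words of length n. Then for every integer n ≥ 4, M_n(q) = M_{n−1}(q) + q^{n−1} · M_{n−2}(q), with M_2(q) = 2 + q and M_3(q) = 2 + q + 2q². -/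
open Finset

/-- The generating polynomial `M_n(q) = ∑_{w ∈ B_n} q^{maj(w)} ∈ ℤ[q]` of the major index
over Fibonacci binary words of length `n`. -/
noncomputable def M (n : ℕ) : Polynomial ℤ := ∑ w ∈ FibWords n, Polynomial.X ^ maj w

theorem maj_eq_sum_fin {n : ℕ} (w : Fin (n + 1) → Fin 2) :
    maj w = ∑ i : Fin n, if w i.castSucc < w i.succ then (i : ℕ) + 1 else 0 := by
  refine Finset.sum_bij' (fun i _ => (⟨i.1, Finset.mem_range.mp i.2⟩ : Fin n))
    (fun i _ => ⟨i.1, Finset.mem_range.mpr i.2⟩) ?_ ?_ ?_ ?_ ?_ <;> intros <;> simp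

theorem maj_snoc {n : ℕ} (w : Fin (n + 1) → Fin 2) (a : Fin 2) :
    maj (Fin.snoc w a : Fin (n + 2) → Fin 2) =
      maj w + if w (Fin.last n) < a then n + 1 else 0 := by
  rw [maj_eq_sum_fin, maj_eq_sum_fin, Fin.sum_univ_castSucc]
  simp only [Fin.snoc_castSucc, Fin.succ_castSucc, Fin.succ_last, Fin.snoc_last,
    Fin.val_castSucc, Fin.val_last]

theorem maj_snoc_zero {n : ℕ} (w : Fin n → Fin 2) :
    maj (Fin.snoc w 0 : Fin (n + 1) → Fin 2) = maj w := by
  cases n with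
  | zero => simp [maj]
  | succ n => simp [maj_snoc]

theorem snoc_zero_mem_fibWords {n : ℕ} (w : Fin n → Fin 2) :
    (Fin.snoc w 0 : Fin (n + 1) → Fin 2) ∈ FibWords (n + 1) ↔ w ∈ FibWords n := by
  simp [FibWords, Fin.forall_fin_succ']

theorem snoc_one_mem_fibWords {n : ℕ} (w : Fin (n + 1) → Fin 2) :
    (Fin.snoc w 1 : Fin (n + 2) → Fin 2) ∈ FibWords (n + 2) ↔
      w ∈ FibWords (n + 1) ∧ w (Fin.last n) = 0 := by
  simp only [FibWords, Finset.mem_filter, Finset.mem_univ, true_and]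
  constructor
  · intro h
    refine ⟨fun i j hij => by simpa using h i.castSucc j.castSucc (by simpa using hij), ?_⟩
    have := h (Fin.last n).castSucc (Fin.last (n + 1)) (by simp)
    simp only [Fin.snoc_castSucc, Fin.snoc_last] at this
    exact not_not.mp fun h0 => this ⟨Fin.eq_one_of_ne_zero _ h0, trivial⟩
  · rintro ⟨h, hl⟩ i j hij
    induction i using Fin.lastCases with
    | last => simp at hij; omega
    | cast i =>
      induction j using Fin.lastCases with
      | last =>
        obtain rfl : i = Fin.last n := by ext; simp at hij ⊢; omega
        simp [hl]
      | cast j => simpa using h i j (by simpa using hij)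

theorem sum_words_succ {R : Type*} [AddCommMonoid R] {n : ℕ} (f : (Fin (n + 1) → Fin 2) → R) :
    ∑ w, f w = ∑ v : Fin n → Fin 2, f (Fin.snoc v 0) + ∑ v : Fin n → Fin 2, f (Fin.snoc v 1) := by
  rw [← (Fin.snocEquiv fun _ : Fin (n + 1) => Fin 2).sum_comp f, Fintype.sum_prod_type,
    Fin.sum_univ_two]
  rfl

theorem M_eq_sum_ite (n : ℕ) :
    M n = ∑ w : Fin n → Fin 2, if w ∈ FibWords n then Polynomial.X ^ maj w else 0 := by
  simp [M]

theorem M_add_two (n : ℕ) : M (n + 2) = M (n + 1) + Polynomial.X ^ (n + 1) * M n := by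
  rw [M_eq_sum_ite (n + 2), sum_words_succ, M_eq_sum_ite (n + 1), M_eq_sum_ite n, Finset.mul_sum]
  congr 1
  · simp only [snoc_zero_mem_fibWords, maj_snoc_zero]
  · rw [sum_words_succ]
    simp [snoc_one_mem_fibWords, snoc_zero_mem_fibWords, maj_snoc, maj_snoc_zero, pow_add,
      mul_comm]

theorem M_zero : M 0 = 1 := by
  simp [M, FibWords, maj]

theorem M_one : M 1 = 2 := by
  rw [M_eq_sum_ite, sum_words_succ]
  simp [FibWords, maj, one_add_one_eq_two]

/-- The recurrence `M_n(q) = M_{n−1}(q) + q^{n−1}·M_{n−2}(q)` for `n ≥ 4`, with initial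
values `M₂(q) = 2 + q` and `M₃(q) = 2 + q + 2q²`. -/
theorem stmt_14 :
    (∀ n : ℕ, 4 ≤ n → M n = M (n - 1) + Polynomial.X ^ (n - 1) * M (n - 2)) ∧
    M 2 = 2 + Polynomial.X ∧
    M 3 = 2 + Polynomial.X + 2 * Polynomial.X ^ 2 := by
  have h2 : M 2 = 2 + Polynomial.X := by
    rw [M_add_two 0, M_zero, M_one]
    ring
  refine ⟨fun n hn => ?_, h2, ?_⟩
  · obtain ⟨k, rfl⟩ := Nat.exists_eq_add_of_le' (show 2 ≤ n by omega)
    exact M_add_two k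
  · rw [M_add_two 1, h2, M_one]
    ring
end

section
/- The formal power series ∑_{n≥0} binom(n,3)·F_{n+1}·x^n in ℤ⟦x⟧, where F denotes the Fibonacci sequence with F₀=0, F₁=1 and F_{n}=F_{n−1}+F_{n−2}, satisfies (1 − x − x²)⁴ · ∑_{n≥0} binom(n,3)·F_{n+1}·x^n = x³(3 + 8x + 6x² + 4x³). -/
open PowerSeries in
/-- The series `∑ C(n,k) F_{n+1} xⁿ` and `∑ C(n,k) F_n xⁿ` are determined by those for `k = 0`
through a linear recurrence in `k`. -/
theorem mk_choose_succ_mul_fib (k : ℕ) :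
    (1 - X - X ^ 2 : ℤ⟦X⟧) * mk (fun n => ((n.choose (k + 1) * Nat.fib (n + 1) : ℕ) : ℤ)) =
        (X + X ^ 2) * mk (fun n => ((n.choose k * Nat.fib (n + 1) : ℕ) : ℤ)) +
          X * mk (fun n => ((n.choose k * Nat.fib n : ℕ) : ℤ)) ∧
      (1 - X - X ^ 2 : ℤ⟦X⟧) * mk (fun n => ((n.choose (k + 1) * Nat.fib n : ℕ) : ℤ)) =
        X * mk (fun n => ((n.choose k * Nat.fib (n + 1) : ℕ) : ℤ)) +
          X ^ 2 * mk (fun n => ((n.choose k * Nat.fib n : ℕ) : ℤ)) := by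
  have hA : mk (fun n => ((n.choose (k + 1) * Nat.fib (n + 1) : ℕ) : ℤ)) =
      X * (mk (fun n => ((n.choose k * Nat.fib (n + 1) : ℕ) : ℤ)) +
        mk (fun n => ((n.choose (k + 1) * Nat.fib (n + 1) : ℕ) : ℤ)) +
        mk (fun n => ((n.choose k * Nat.fib n : ℕ) : ℤ)) +
        mk (fun n => ((n.choose (k + 1) * Nat.fib n : ℕ) : ℤ))) := by
    ext (_ | n)
    · simp
    · simp only [coeff_succ_X_mul, map_add, coeff_mk, Nat.choose_succ_succ' n k,
        Nat.fib_add_two (n := n)]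
      push_cast
      ring
  have hB : mk (fun n => ((n.choose (k + 1) * Nat.fib n : ℕ) : ℤ)) =
      X * (mk (fun n => ((n.choose k * Nat.fib (n + 1) : ℕ) : ℤ)) +
        mk (fun n => ((n.choose (k + 1) * Nat.fib (n + 1) : ℕ) : ℤ))) := by
    ext (_ | n)
    · simp
    · simp only [coeff_succ_X_mul, map_add, coeff_mk, Nat.choose_succ_succ' n k]
      push_cast
      ring
  constructor
  · linear_combination hA + X * hB
  · linear_combination X * hA + (1 - X) * hB

open PowerSeries in
theorem mk_choose_zero_mul_fib :
    (1 - X - X ^ 2 : ℤ⟦X⟧) * mk (fun n => ((n.choose 0 * Nat.fib (n + 1) : ℕ) : ℤ)) = 1 ∧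
      (1 - X - X ^ 2 : ℤ⟦X⟧) * mk (fun n => ((n.choose 0 * Nat.fib n : ℕ) : ℤ)) = X := by
  have hA : mk (fun n => ((n.choose 0 * Nat.fib (n + 1) : ℕ) : ℤ)) =
      1 + X * (mk (fun n => ((n.choose 0 * Nat.fib (n + 1) : ℕ) : ℤ)) +
        mk (fun n => ((n.choose 0 * Nat.fib n : ℕ) : ℤ))) := by
    ext (_ | n)
    · simp
    · simp [coeff_succ_X_mul, coeff_one, Nat.fib_add_two (n := n), add_comm (Nat.fib n : ℤ)]
  have hB : mk (fun n => ((n.choose 0 * Nat.fib n : ℕ) : ℤ)) =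
      X * mk (fun n => ((n.choose 0 * Nat.fib (n + 1) : ℕ) : ℤ)) := by
    ext (_ | n)
    · simp
    · simp [coeff_succ_X_mul]
  constructor
  · linear_combination hA + X * hB
  · linear_combination X * hA + (1 - X) * hB

/-- The generating function identity
`(1 − x − x²)⁴ · ∑_{n≥0} C(n,3)·F_{n+1}·xⁿ = x³(3 + 8x + 6x² + 4x³)` in `ℤ⟦x⟧`,
where `F` is the Fibonacci sequence with `F₀ = 0`, `F₁ = 1`. -/
theorem stmt_15 :
    ((1 : PowerSeries ℤ) - PowerSeries.X - PowerSeries.X ^ 2) ^ 4 *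
        PowerSeries.mk (fun n => ((n.choose 3 * Nat.fib (n + 1) : ℕ) : ℤ)) =
      PowerSeries.X ^ 3 *
        (3 + 8 * PowerSeries.X + 6 * PowerSeries.X ^ 2 + 4 * PowerSeries.X ^ 3) := by
  obtain ⟨a0, b0⟩ := mk_choose_zero_mul_fib
  obtain ⟨a1, b1⟩ := mk_choose_succ_mul_fib 0
  obtain ⟨a2, b2⟩ := mk_choose_succ_mul_fib 1
  obtain ⟨a3, -⟩ := mk_choose_succ_mul_fib 2
  simp only [zero_add, Nat.reduceAdd] at a1 b1 a2 b2 a3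
  set x : PowerSeries ℤ := PowerSeries.X
  set p := 1 - x - x ^ 2
  have hA1 : p ^ 2 * PowerSeries.mk (fun n => ((n.choose 1 * Nat.fib (n + 1) : ℕ) : ℤ)) =
      x + 2 * x ^ 2 := by
    linear_combination p * a1 + (x + x ^ 2) * a0 + x * b0
  have hB1 : p ^ 2 * PowerSeries.mk (fun n => ((n.choose 1 * Nat.fib n : ℕ) : ℤ)) =
      x + x ^ 3 := by
    linear_combination p * b1 + x * a0 + x ^ 2 * b0
  have hA2 : p ^ 3 * PowerSeries.mk (fun n => ((n.choose 2 * Nat.fib (n + 1) : ℕ) : ℤ)) =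
      (x + x ^ 2) * (x + 2 * x ^ 2) + x * (x + x ^ 3) := by
    linear_combination p ^ 2 * a2 + (x + x ^ 2) * hA1 + x * hB1
  have hB2 : p ^ 3 * PowerSeries.mk (fun n => ((n.choose 2 * Nat.fib n : ℕ) : ℤ)) =
      x * (x + 2 * x ^ 2) + x ^ 2 * (x + x ^ 3) := by
    linear_combination p ^ 2 * b2 + x * hA1 + x ^ 2 * hB1
  linear_combination p ^ 3 * a3 + (x + x ^ 2) * hA2 + x * hB2
end

section
/- For every integer n ≥ 3, in the set S_n(123,132,231): f_{213}(S_n(123,132,231)) = f_{312}(S_n(123,132,231)) = binom(n,3), and f_{321}(S_n(123,132,231)) = (n−2)·binom(n,3). -/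
open Finset

/-- The permutation of `Fin (m + 1)` whose last value is `k` and whose other values decrease. -/
def decreasingThenLast {m : ℕ} (k : Fin (m + 1)) : Equiv.Perm (Fin (m + 1)) :=
  Fin.revPerm.trans k.cycleRange.symm

lemma decreasingThenLast_last {m : ℕ} (k : Fin (m + 1)) :
    decreasingThenLast k (Fin.last m) = k := by
  simp [decreasingThenLast]

lemma decreasingThenLast_symm_lt_iff {m : ℕ} (k x y : Fin (m + 1)) :
    (decreasingThenLast k).symm x < (decreasingThenLast k).symm y ↔
      x ≠ k ∧ x ≠ y ∧ (y = k ∨ y < x) := by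
  simp only [decreasingThenLast, Equiv.symm_trans_apply, Equiv.symm_symm, Fin.revPerm_symm,
    Fin.revPerm_apply, Fin.rev_lt_rev]
  rcases eq_or_ne x k with rfl | hx
  · simp
  obtain ⟨i, rfl⟩ := Fin.exists_succAbove_eq hx
  rcases eq_or_ne y k with rfl | hy
  · simp
  obtain ⟨j, rfl⟩ := Fin.exists_succAbove_eq hy
  simp only [Fin.cycleRange_succAbove, Fin.succ_lt_succ_iff, Fin.succAbove_lt_succAbove_iff,
    ne_eq, Fin.succAbove_ne, Fin.succAbove_right_inj]
  grind

lemma perm_eq_of_symm_lt_iff {n : ℕ} {σ τ : Equiv.Perm (Fin n)}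
    (h : ∀ x y, σ.symm x < σ.symm y ↔ τ.symm x < τ.symm y) : σ = τ := by
  let e : Fin n ≃o Fin n :=
    { toEquiv := σ.trans τ.symm
      map_rel_iff' := fun {a b} => by
        have := h (σ b) (σ a)
        simp only [Equiv.symm_apply_apply] at this
        simpa using (not_congr this).symm }
  ext i
  have := congrArg (fun f : Fin n ≃o Fin n => τ (f i)) (Subsingleton.elim e (OrderIso.refl _))
  simpa [e] using congrArg Fin.val this

/-- Occurrences of a pattern may be counted by their values instead of their positions. -/
lemma occ_eq_card_values (n : ℕ) (q : Fin 3 → ℕ) (σ : Equiv.Perm (Fin n)) :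
    occ n q σ = #{x : Fin 3 → Fin n | (∀ j l, q j < q l ↔ x j < x l) ∧
      ∀ j l : Fin 3, j < l → σ.symm (x j) < σ.symm (x l)} := by
  refine Finset.card_equiv ((Equiv.refl _).arrowCongr σ) fun ι => ?_
  simp [and_comm]

lemma occ_decreasingThenLast {m : ℕ} (q : Fin 3 → ℕ) (k : Fin (m + 1)) :
    occ (m + 1) q (decreasingThenLast k) =
      #{x : Fin 3 → Fin (m + 1) | (∀ j l, q j < q l ↔ x j < x l) ∧
        ∀ j l : Fin 3, j < l → x j ≠ k ∧ x j ≠ x l ∧ (x l = k ∨ x l < x j)} := by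
  simp only [occ_eq_card_values, decreasingThenLast_symm_lt_iff]

lemma mem_avoiders_iff_s16 {n : ℕ} {σ : Equiv.Perm (Fin n)} :
    σ ∈ avoiders n [p123, p132, p231] ↔ occ n p123 σ = 0 ∧ occ n p132 σ = 0 ∧ occ n p231 σ = 0 := by
  rw [avoiders, mem_filter]
  simp

lemma decreasingThenLast_mem_avoiders {m : ℕ} (k : Fin (m + 1)) :
    decreasingThenLast k ∈ avoiders (m + 1) [p123, p132, p231] := by
  simp only [mem_avoiders_iff_s16, occ_decreasingThenLast, card_eq_zero, filter_eq_empty_iff, mem_univ,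
    forall_true_left]
  refine ⟨?_, ?_, ?_⟩ <;> intro x ⟨h, h'⟩ <;>
    simp [Fin.forall_fin_succ, p123, p132, p231] at h h' <;> grind

lemma lt_of_mem_avoiders {m : ℕ} {σ : Equiv.Perm (Fin (m + 1))}
    (hσ : σ ∈ avoiders (m + 1) [p123, p132, p231]) {i j : Fin (m + 1)} (hij : i < j)
    (hj : j ≠ Fin.last m) : σ j < σ i := by
  have hjl : j < Fin.last m := Fin.lt_last_iff_ne_last.2 hj
  simp only [mem_avoiders_iff_s16, occ, card_eq_zero, filter_eq_empty_iff, mem_univ,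
    forall_true_left] at hσ
  obtain ⟨h1, h2, h3⟩ := hσ
  have h1 := @h1 ![i, j, Fin.last m]
  have h2 := @h2 ![i, j, Fin.last m]
  have h3 := @h3 ![i, j, Fin.last m]
  simp [Fin.forall_fin_succ, p123, p132, p231] at h1 h2 h3
  have := σ.injective.ne hij.ne
  have := σ.injective.ne hjl.ne
  have := σ.injective.ne (hij.trans hjl).ne
  grind

lemma eq_decreasingThenLast_of_mem_avoiders {m : ℕ} {σ : Equiv.Perm (Fin (m + 1))}
    (hσ : σ ∈ avoiders (m + 1) [p123, p132, p231]) :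
    decreasingThenLast (σ (Fin.last m)) = σ := by
  refine perm_eq_of_symm_lt_iff fun x y => ?_
  obtain ⟨i, rfl⟩ := σ.surjective x
  obtain ⟨j, rfl⟩ := σ.surjective y
  rw [decreasingThenLast_symm_lt_iff]
  simp only [Equiv.symm_apply_apply, ne_eq, EmbeddingLike.apply_eq_iff_eq]
  have hi := Fin.le_last i
  have hj := Fin.le_last j
  have h1 := @lt_of_mem_avoiders m σ hσ i j
  have h2 := @lt_of_mem_avoiders m σ hσ j i
  grind

lemma fCnt_eq_sum (m : ℕ) (q : Fin 3 → ℕ) :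
    fCnt (m + 1) q [p123, p132, p231] =
      ∑ k : Fin (m + 1), occ (m + 1) q (decreasingThenLast k) := by
  refine Finset.sum_bij' (fun σ _ => σ (Fin.last m)) (fun k _ => decreasingThenLast k)
    (fun _ _ => mem_univ _) (fun k _ => decreasingThenLast_mem_avoiders k)
    (fun σ hσ => eq_decreasingThenLast_of_mem_avoiders hσ)
    (fun k _ => decreasingThenLast_last k)
    (fun σ hσ => by rw [eq_decreasingThenLast_of_mem_avoiders hσ])

lemma card_filter_strictMono (k n : ℕ) : #{x : Fin k → Fin n | StrictMono x} = n.choose k := by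
  trans #(powersetCard k (univ : Finset (Fin n)))
  swap
  · simp
  refine Finset.card_bij' (fun x _ => univ.image x)
    (fun s hs => s.orderEmbOfFin (mem_powersetCard.1 hs).2) ?_ ?_ ?_ ?_
  · intro x hx
    simp only [mem_filter, mem_univ, true_and] at hx
    simp [card_image_of_injective _ hx.injective]
  · intro s hs
    simp [OrderEmbedding.strictMono]
  · intro x hx
    simp only [mem_filter, mem_univ, true_and] at hx
    exact (orderEmbOfFin_unique _ (fun i => mem_image_of_mem x (mem_univ i)) hx).symm
  · intro s hs
    exact image_orderEmbOfFin_univ s _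

/-- The words over `Fin n` that are order isomorphic to a given pattern are counted by a binomial
coefficient. -/
lemma card_orderIsomorphic {k : ℕ} (n : ℕ) (q : Fin k → ℕ) (e : Equiv.Perm (Fin k))
    (he : StrictMono (q ∘ e)) :
    #{x : Fin k → Fin n | ∀ j l, q j < q l ↔ x j < x l} = n.choose k := by
  rw [← card_filter_strictMono]
  refine Finset.card_equiv (e.symm.arrowCongr (Equiv.refl _)) fun x => ?_
  simp only [mem_filter, mem_univ, true_and]
  constructor
  · intro h i j hij
    exact (h _ _).1 (he hij)
  · intro h j l
    obtain ⟨j, rfl⟩ := e.surjective j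
    obtain ⟨l, rfl⟩ := e.surjective l
    exact (he.lt_iff_lt (a := j) (b := l)).trans (h.lt_iff_lt (a := j) (b := l)).symm

lemma sum_occ_of_iff {m : ℕ} (q : Fin 3 → ℕ)
    (h : ∀ (k : Fin (m + 1)) (x : Fin 3 → Fin (m + 1)), (∀ j l, q j < q l ↔ x j < x l) →
      ((∀ j l : Fin 3, j < l → x j ≠ k ∧ x j ≠ x l ∧ (x l = k ∨ x l < x j)) ↔ x 2 = k)) :
    ∑ k : Fin (m + 1), occ (m + 1) q (decreasingThenLast k) =
      #{x : Fin 3 → Fin (m + 1) | ∀ j l, q j < q l ↔ x j < x l} := by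
  rw [Finset.card_eq_sum_card_fiberwise (f := fun x => x 2) (t := univ) (by simp)]
  refine Finset.sum_congr rfl fun k _ => ?_
  rw [occ_decreasingThenLast, filter_filter]
  exact congrArg card (filter_congr fun x _ => and_congr_right (h k x))

lemma sum_occ_p321 (m : ℕ) :
    ∑ k : Fin (m + 1), occ (m + 1) p321 (decreasingThenLast k) =
      (m + 1 - 2) * #{x : Fin 3 → Fin (m + 1) | ∀ j l, p321 j < p321 l ↔ x j < x l} := by
  set T := ({x : Fin 3 → Fin (m + 1) | ∀ j l, p321 j < p321 l ↔ x j < x l} : Finset _) with hT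
  have h1 (k : Fin (m + 1)) : occ (m + 1) p321 (decreasingThenLast k) =
      #(T.bipartiteAbove (fun k x => x 0 ≠ k ∧ x 1 ≠ k) k) := by
    rw [occ_decreasingThenLast, bipartiteAbove, hT, filter_filter]
    refine congrArg card (filter_congr fun x _ => and_congr_right fun h => ?_)
    simp [Fin.forall_fin_succ, p321] at h ⊢
    grind
  have h2 (x) (hx : x ∈ T) :
      #((univ : Finset (Fin (m + 1))).bipartiteBelow (fun k x => x 0 ≠ k ∧ x 1 ≠ k) x) =
        m + 1 - 2 := by
    have hne : x 0 ≠ x 1 := by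
      have := ((mem_filter.1 hx).2 1 0).1 (by decide)
      exact this.ne'
    have : (univ : Finset (Fin (m + 1))).bipartiteBelow (fun k x => x 0 ≠ k ∧ x 1 ≠ k) x =
        ({x 0, x 1} : Finset _)ᶜ := by
      ext k
      simp [bipartiteBelow, eq_comm]
    rw [this, card_compl, card_pair hne, Fintype.card_fin]
  rw [Finset.sum_congr rfl fun k _ => h1 k,
    sum_card_bipartiteAbove_eq_sum_card_bipartiteBelow, Finset.sum_congr rfl h2, sum_const,
    smul_eq_mul, mul_comm]

/-- Pattern counts in `S_n(123,132,231)` for `n ≥ 3`: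
`f_{213} = f_{312} = C(n,3)` and `f_{321} = (n−2)·C(n,3)`. -/
theorem stmt_16 (n : ℕ) (hn : 3 ≤ n) :
    (fCnt n p213 [p123, p132, p231] = n.choose 3 ∧
     fCnt n p312 [p123, p132, p231] = n.choose 3) ∧
    fCnt n p321 [p123, p132, p231] = (n - 2) * n.choose 3 := by
  obtain ⟨m, rfl⟩ : ∃ m, n = m + 1 := ⟨n - 1, by omega⟩
  refine ⟨⟨?_, ?_⟩, ?_⟩
  · rw [fCnt_eq_sum, sum_occ_of_iff, card_orderIsomorphic (e := Equiv.swap 0 1)]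
    · simp only [StrictMono]
      decide
    · intro k x h
      simp [Fin.forall_fin_succ, p213] at h ⊢
      grind
  · rw [fCnt_eq_sum, sum_occ_of_iff, card_orderIsomorphic (e := finRotate 3)]
    · simp only [StrictMono]
      decide
    · intro k x h
      simp [Fin.forall_fin_succ, p312] at h ⊢
      grind
  · rw [fCnt_eq_sum, sum_occ_p321, card_orderIsomorphic (e := Fin.revPerm)]
    simp only [StrictMono]
    decide
end
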